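/- Let N be a positive integer, let a₀ : [0,1) → ℝ be smooth with a₀(0) ≥ −1/4, and define the regular singular potential q(x) := a₀(x^(1/N))·x^(−2) for x ∈ (0,1), and ν₀ := √(a₀(0) + 1/4). Then there exists exactly one twice continuously differentiable function φ : (0,1) → ℝ satisfying φ''(x) = q(x)·φ(x) for all x ∈ (0,1) together with the normalization lim_{x→0⁺} x^(−(ν₀+1/2))·φ(x) = 1; moreover this φ satisfies φ(x) = x^(ν₀+1/2)·(1 + O(x^(1/N))) as x → 0⁺. (φ is called the normalized solution of lf = 0 at 0, where l = −d²/dx² + q.) -/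

import Mathlib

open Set Filter

theorem nsol_int (R M β : ℝ) (hβ : 0 < β) (g : ℝ → ℝ)
    (hg : ContinuousOn g (Ioo 0 R)) (hb : ∀ z ∈ Ioo 0 R, |g z| ≤ M * z ^ (β - 1)) :
    ∀ x ∈ Ioo 0 R, HasDerivAt (fun y => ∫ z in (0:ℝ)..y, g z) (g x) x ∧
      |∫ z in (0:ℝ)..x, g z| ≤ M / β * x ^ β := by
  intro x hx
  have hrp : IntervalIntegrable (fun z : ℝ => M * z ^ (β - 1)) MeasureTheory.volume 0 x :=
    (intervalIntegral.intervalIntegrable_rpow' (by linarith)).const_mul _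
  have hsub : uIoc (0:ℝ) x ⊆ Ioo 0 R := by
    rw [uIoc_of_le hx.1.le]
    exact fun z hz => ⟨hz.1, hz.2.trans_lt hx.2⟩
  have hint : IntervalIntegrable g MeasureTheory.volume 0 x := by
    refine hrp.mono_fun' ((hg.mono hsub).aestronglyMeasurable measurableSet_uIoc) ?_
    refine (MeasureTheory.ae_restrict_mem measurableSet_uIoc).mono fun z hz => ?_
    exact hb z (hsub hz)
  refine ⟨intervalIntegral.integral_hasDerivAt_right hint ?_ ?_, ?_⟩
  · exact hg.stronglyMeasurableAtFilter isOpen_Ioo x hx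
  · exact hg.continuousAt (isOpen_Ioo.mem_nhds hx)
  · have := intervalIntegral.norm_integral_le_of_norm_le (f := g) hx.1.le
      (Filter.Eventually.of_forall fun z hz => hb z (hsub (by rwa [uIoc_of_le hx.1.le]))) hrp
    refine this.trans (le_of_eq ?_)
    rw [intervalIntegral.integral_const_mul, integral_rpow (Or.inl (by linarith))]
    rw [show β - 1 + 1 = β by ring, Real.zero_rpow hβ.ne']
    ring

noncomputable def nsolU (ν : ℝ) (b : ℝ → ℝ) : ℕ → ℝ → ℝ
  | 0 => fun _ => 1
  | n + 1 => fun x => ∫ y in (0:ℝ)..x, y ^ (-2 * ν - 1) *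
      ∫ z in (0:ℝ)..y, z ^ (2 * ν - 1) * b z * nsolU ν b n z

noncomputable def nsolP (ν : ℝ) (b : ℝ → ℝ) (n : ℕ) (y : ℝ) : ℝ :=
  ∫ z in (0:ℝ)..y, z ^ (2 * ν - 1) * b z * nsolU ν b n z

theorem nsol_pow_cont (p R : ℝ) : ContinuousOn (fun x : ℝ => x ^ p) (Ioo 0 R) :=
  fun x hx => (Real.continuousAt_rpow_const x p (Or.inl hx.1.ne')).continuousWithinAt

theorem nsol_P (ν α : ℝ) (hν : 0 ≤ ν) (hα : 0 < α) (b : ℝ → ℝ) (R C D : ℝ) (n : ℕ)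
    (hC : 0 ≤ C) (hD : 0 ≤ D)
    (hbc : ContinuousOn b (Ioo 0 R)) (hb : ∀ x ∈ Ioo 0 R, |b x| ≤ C * x ^ α)
    (hU : ContinuousOn (nsolU ν b n) (Ioo 0 R))
    (hUb : ∀ x ∈ Ioo 0 R, |nsolU ν b n x| ≤ D * x ^ (α * n)) :
    ∀ x ∈ Ioo 0 R, HasDerivAt (nsolP ν b n) (x ^ (2 * ν - 1) * b x * nsolU ν b n x) x ∧
      |nsolP ν b n x| ≤ C * D / α * x ^ (2 * ν + α * (n + 1)) := by
  intro x hx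
  have hβ : α ≤ 2 * ν + α * (n + 1) := by
    have : 0 ≤ α * n := by positivity
    linarith
  have := nsol_int R (C * D) (2 * ν + α * (n + 1)) (hα.trans_le hβ)
    (fun z => z ^ (2 * ν - 1) * b z * nsolU ν b n z)
    (((nsol_pow_cont _ R).mul hbc).mul hU) (by
      intro z hz
      rw [abs_mul, abs_mul, abs_of_pos (Real.rpow_pos_of_pos hz.1 _)]
      calc z ^ (2 * ν - 1) * |b z| * |nsolU ν b n z|
          ≤ z ^ (2 * ν - 1) * (C * z ^ α) * (D * z ^ (α * n)) := by
            have := Real.rpow_pos_of_pos hz.1 (2 * ν - 1)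
            have h2 := Real.rpow_pos_of_pos hz.1 α
            gcongr
            · exact hb z hz
            · exact hUb z hz
        _ = C * D * (z ^ (2 * ν - 1) * z ^ α * z ^ (α * n)) := by ring
        _ = _ := by
            rw [← Real.rpow_add hz.1, ← Real.rpow_add hz.1]
            congr 2; ring) x hx
  refine ⟨this.1, this.2.trans ?_⟩
  have := Real.rpow_pos_of_pos hx.1 (2 * ν + α * (n + 1))
  gcongr

theorem nsol_U (ν α : ℝ) (hν : 0 ≤ ν) (hα : 0 < α) (b : ℝ → ℝ) (R C : ℝ)
    (hC : 0 ≤ C)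
    (hbc : ContinuousOn b (Ioo 0 R)) (hb : ∀ x ∈ Ioo 0 R, |b x| ≤ C * x ^ α) (n : ℕ) :
    ContinuousOn (nsolU ν b n) (Ioo 0 R) ∧
    (∀ x ∈ Ioo 0 R, |nsolU ν b n x| ≤ (C / α ^ 2) ^ n / n.factorial * x ^ (α * n)) ∧
    ∀ x ∈ Ioo 0 R, HasDerivAt (nsolU ν b (n + 1)) (x ^ (-2 * ν - 1) * nsolP ν b n x) x := by
  have step : ∀ n : ℕ, ContinuousOn (nsolU ν b n) (Ioo 0 R) →
      (∀ x ∈ Ioo 0 R, |nsolU ν b n x| ≤ (C / α ^ 2) ^ n / n.factorial * x ^ (α * n)) →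
      ∀ x ∈ Ioo 0 R, HasDerivAt (nsolU ν b (n + 1)) (x ^ (-2 * ν - 1) * nsolP ν b n x) x ∧
        |nsolU ν b (n + 1) x| ≤
          (C / α ^ 2) ^ (n + 1) / (n + 1).factorial * x ^ (α * ((n + 1 : ℕ) : ℝ)) := by
    intro n h1 h2 x hx
    have hP := nsol_P ν α hν hα b R C _ n hC (by positivity) hbc hb h1 h2
    have := nsol_int R (C * ((C / α ^ 2) ^ n / n.factorial) / α) (α * (n + 1)) (by positivity)
      (fun y => y ^ (-2 * ν - 1) * nsolP ν b n y)
      ((nsol_pow_cont _ R).mul (fun y hy => (hP y hy).1.continuousAt.continuousWithinAt)) (by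
        intro y hy
        rw [abs_mul, abs_of_pos (Real.rpow_pos_of_pos hy.1 _)]
        have := Real.rpow_pos_of_pos hy.1 (-2 * ν - 1)
        refine (mul_le_mul_of_nonneg_left (hP y hy).2 this.le).trans (le_of_eq ?_)
        rw [mul_left_comm, ← Real.rpow_add hy.1]
        congr 2; ring) x hx
    refine ⟨this.1, this.2.trans (le_of_eq ?_)⟩
    push_cast [Nat.factorial_succ, pow_succ]
    field_simp
  have main : ContinuousOn (nsolU ν b n) (Ioo 0 R) ∧
    (∀ x ∈ Ioo 0 R, |nsolU ν b n x| ≤ (C / α ^ 2) ^ n / n.factorial * x ^ (α * n)) := by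
    induction n with
    | zero => exact ⟨continuousOn_const, by simp [nsolU]⟩
    | succ n ih =>
      have := step n ih.1 ih.2
      exact ⟨fun y hy => (this y hy).1.continuousAt.continuousWithinAt, fun y hy => (this y hy).2⟩
  exact ⟨main.1, main.2, fun x hx => (step n main.1 main.2 x hx).1⟩

theorem nsol_lip (α : ℝ) (hα : 0 < α) (a : ℝ → ℝ) (ha : ContDiffOn ℝ (⊤ : ℕ∞) a (Ico 0 1))
   (R : ℝ) (hR : R < 1) : ∃ C : ℝ, 0 ≤ C ∧ ∀ x ∈ Ioo 0 R, |a (x ^ α) - a 0| ≤ C * x ^ α := by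
  rcases le_or_gt R 0 with h | h
  · exact ⟨0, le_rfl, fun x hx => absurd (hx.1.trans hx.2) (not_lt.2 h)⟩
  have hR1 : R ^ α < 1 := Real.rpow_lt_one h.le hR hα
  obtain ⟨K, hK⟩ := (ha.mono (fun x hx => ⟨hx.1, hx.2.trans_lt hR1⟩ :
    Icc 0 (R ^ α) ⊆ Ico 0 1)).exists_lipschitzOnWith (by simp) (convex_Icc _ _) isCompact_Icc
  refine ⟨K, K.2, fun x hx => ?_⟩
  have hx0 := Real.rpow_pos_of_pos hx.1 α
  have := hK.dist_le_mul (x ^ α) ⟨hx0.le, Real.rpow_le_rpow hx.1.le hx.2.le hα.le⟩ 0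
    ⟨le_rfl, (Real.rpow_pos_of_pos h α).le⟩
  rwa [Real.dist_eq, Real.dist_eq, sub_zero, abs_of_pos hx0] at this

theorem nsol_exists (ν α : ℝ) (hν : 0 ≤ ν) (hα : 0 < α) (b : ℝ → ℝ)
    (hbc : ContinuousOn b (Ioo 0 1))
    (hb : ∀ R : ℝ, R < 1 → ∃ C : ℝ, 0 ≤ C ∧ ∀ x ∈ Ioo 0 R, |b x| ≤ C * x ^ α) :
    ∃ u P : ℝ → ℝ, (∀ x ∈ Ioo (0:ℝ) 1, HasDerivAt u (x ^ (-2 * ν - 1) * P x) x ∧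
      HasDerivAt P (x ^ (2 * ν - 1) * b x * u x) x) ∧
      ∃ C, ∀ x ∈ Ioo (0:ℝ) (1/2), |u x - 1| ≤ C * x ^ α := by
  refine ⟨fun x => 1 + ∑' n, nsolU ν b (n + 1) x, fun x => ∑' n, nsolP ν b n x, ?_, ?_⟩
  · intro x hx
    obtain ⟨R, hxR, hR1⟩ := exists_between hx.2
    obtain ⟨C, hC, hbC⟩ := hb R hR1
    have hbcR : ContinuousOn b (Ioo 0 R) := hbc.mono (Ioo_subset_Ioo_right hR1.le)
    have hU := nsol_U ν α hν hα b R C hC hbcR hbC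
    have hP := fun n => nsol_P ν α hν hα b R C _ n hC
      (by positivity : 0 ≤ (C / α ^ 2) ^ n / n.factorial) hbcR hbC (hU n).1 (hU n).2.1
    set K := C / α ^ 2 with hK
    have hS : Summable (fun n : ℕ => K ^ n / n.factorial) := Real.summable_pow_div_factorial K
    have hK0 : 0 ≤ K := by positivity
    have hUb : ∀ n, ∀ y ∈ Ioo 0 R, |nsolU ν b n y| ≤ K ^ n / n.factorial := by
      intro n y hy
      refine ((hU n).2.1 y hy).trans ?_
      have : y ^ (α * n) ≤ 1 :=
        Real.rpow_le_one hy.1.le (hy.2.trans hR1).le (by positivity)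
      exact mul_le_of_le_one_right (by positivity) this
    have hPb : ∀ n, ∀ y ∈ Ioo 0 R, |nsolP ν b n y| ≤ C / α * (K ^ n / n.factorial) := by
      intro n y hy
      refine ((hP n) y hy).2.trans ?_
      have : y ^ (2 * ν + α * (n + 1)) ≤ 1 :=
        Real.rpow_le_one hy.1.le (hy.2.trans hR1).le (by positivity)
      refine (mul_le_of_le_one_right (by positivity) this).trans (le_of_eq (by ring))
    have hxR' : x ∈ Ioo 0 R := ⟨hx.1, hxR⟩
    have hsU : Summable (fun n => nsolU ν b n x) :=
      Summable.of_norm_bounded hS (fun n => hUb n x hxR')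
    have hsP : Summable (fun n => nsolP ν b n x) :=
      Summable.of_norm_bounded (hS.mul_left (C / α)) (fun n => hPb n x hxR')
    have hx2 : 0 < x / 2 := by linarith [hx.1]
    have hmem : x ∈ Ioo (x / 2) R := ⟨by linarith [hx.1], hxR⟩
    have hsub : ∀ y ∈ Ioo (x / 2) R, y ∈ Ioo 0 R := fun y hy => ⟨hx2.trans hy.1, hy.2⟩
    constructor
    · have := hasDerivAt_tsum_of_isPreconnected (g := fun n => nsolU ν b (n + 1))
        (g' := fun n y => y ^ (-2 * ν - 1) * nsolP ν b n y)
        (t := Ioo (x / 2) R) (y₀ := x) (y := x)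
        (u := fun n => (x / 2) ^ (-2 * ν - 1) * (C / α * (K ^ n / n.factorial)))
        ((hS.mul_left _).mul_left _) isOpen_Ioo isPreconnected_Ioo
        (fun n y hy => (hU n).2.2 y (hsub y hy))
        (by
          intro n y hy
          have hy' := hsub y hy
          rw [Real.norm_eq_abs, abs_mul, abs_of_pos (Real.rpow_pos_of_pos hy'.1 _)]
          refine mul_le_mul ?_ (hPb n y hy') (abs_nonneg _) (Real.rpow_pos_of_pos hx2 _).le
          exact Real.rpow_le_rpow_of_nonpos hx2 hy.1.le (by linarith)) hmem
        ((summable_nat_add_iff 1).2 hsU) hmem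
      rw [tsum_mul_left] at this
      exact this.const_add 1
    · have := hasDerivAt_tsum_of_isPreconnected (g := fun n => nsolP ν b n)
        (g' := fun n y => y ^ (2 * ν - 1) * b y * nsolU ν b n y)
        (t := Ioo (x / 2) R) (y₀ := x) (y := x)
        (u := fun n => (x / 2) ^ (-1 : ℝ) * C * (K ^ n / n.factorial))
        (hS.mul_left _) isOpen_Ioo isPreconnected_Ioo
        (fun n y hy => (hP n y (hsub y hy)).1)
        (by
          intro n y hy
          have hy' := hsub y hy
          rw [Real.norm_eq_abs, abs_mul, abs_mul, abs_of_pos (Real.rpow_pos_of_pos hy'.1 _)]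
          have h0 := Real.rpow_pos_of_pos hx2 (-1)
          have hy1 := (hy'.2.trans hR1).le
          have h1 : y ^ (2 * ν - 1) ≤ (x / 2) ^ (-1 : ℝ) :=
            (Real.rpow_le_rpow_of_exponent_ge hy'.1 hy1 (by linarith)).trans
              (Real.rpow_le_rpow_of_nonpos hx2 hy.1.le (by norm_num))
          have h2 : |b y| ≤ C := (hbC y hy').trans
            (mul_le_of_le_one_right hC (Real.rpow_le_one hy'.1.le hy1 hα.le))
          have h3 := hUb n y hy'
          gcongr) hmem
        hsP hmem
      rw [tsum_mul_left, hsU.tsum_eq_zero_add] at this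
      exact this
  · obtain ⟨C, hC, hbC⟩ := hb (1/2) (by norm_num)
    have hbcR : ContinuousOn b (Ioo 0 (1/2)) := hbc.mono (Ioo_subset_Ioo_right (by norm_num))
    have hU := nsol_U ν α hν hα b (1/2) C hC hbcR hbC
    set K := C / α ^ 2 with hK
    have hK0 : 0 ≤ K := by positivity
    have hS : Summable (fun n : ℕ => K ^ n / n.factorial) := Real.summable_pow_div_factorial K
    have hS1 : Summable (fun n : ℕ => K ^ (n + 1) / (n + 1).factorial) :=
      (summable_nat_add_iff (f := fun n : ℕ => K ^ n / n.factorial) 1).2 hS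
    refine ⟨∑' n : ℕ, K ^ (n + 1) / (n + 1).factorial, fun x hx => ?_⟩
    rw [add_sub_cancel_left, ← tsum_mul_right]
    rw [← Real.norm_eq_abs]
    refine tsum_of_norm_bounded (hS1.mul_right (x ^ α)).hasSum fun n => ?_
    refine ((hU (n + 1)).2.1 x hx).trans ?_
    have : x ^ (α * ((n + 1 : ℕ) : ℝ)) ≤ x ^ α := by
      refine Real.rpow_le_rpow_of_exponent_ge hx.1 (by linarith [hx.2]) ?_
      push_cast
      nlinarith [(Nat.cast_nonneg n : (0:ℝ) ≤ n)]
    gcongr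

theorem nsol_ode (q φ φd ψ ψd : ℝ → ℝ) (hq : ContinuousOn q (Ioo 0 1))
    (h1 : ∀ x ∈ Ioo (0:ℝ) 1, HasDerivAt φ (φd x) x)
    (h2 : ∀ x ∈ Ioo (0:ℝ) 1, HasDerivAt φd (q x * φ x) x)
    (h3 : ∀ x ∈ Ioo (0:ℝ) 1, HasDerivAt ψ (ψd x) x)
    (h4 : ∀ x ∈ Ioo (0:ℝ) 1, HasDerivAt ψd (q x * ψ x) x)
    (c : ℝ) (hc : c ∈ Ioo (0:ℝ) 1) (e1 : φ c = ψ c) (e2 : φd c = ψd c) :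
    EqOn φ ψ (Ioo 0 1) := by
  intro x hx
  obtain ⟨a, ha0, ha⟩ := exists_between (lt_min hc.1 hx.1)
  obtain ⟨b, hb, hb1⟩ := exists_between (max_lt hc.2 hx.2)
  rw [lt_min_iff] at ha
  rw [max_lt_iff] at hb
  have hsub : Icc a b ⊆ Ioo 0 1 := fun y hy => ⟨ha0.trans_le hy.1, hy.2.trans_lt hb1⟩
  obtain ⟨Q, hQ⟩ := isCompact_Icc.exists_bound_of_continuousOn (hq.mono hsub)
  have hs : ∀ t ∈ Ioo a b, t ∈ Ioo (0:ℝ) 1 := fun t ht => hsub (Ioo_subset_Icc_self ht)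
  have := ODE_solution_unique_of_mem_Ioo (a := a) (b := b) (t₀ := c)
    (v := fun t (p : ℝ × ℝ) => (p.2, q t * p.1)) (s := fun _ => univ)
    (K := Real.toNNReal (max 1 Q)) (f := fun t => (φ t, φd t)) (g := fun t => (ψ t, ψd t))
    (by
      intro t ht
      refine LipschitzOnWith.of_dist_le_mul fun p _ p' _ => ?_
      rw [Real.coe_toNNReal _ (by positivity), Prod.dist_eq, Prod.dist_eq]
      have hQt := hQ t (Ioo_subset_Icc_self ht)
      rw [Real.norm_eq_abs] at hQt
      refine max_le ?_ ?_
      · calc dist p.2 p'.2 ≤ 1 * dist p.2 p'.2 := by rw [one_mul]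
          _ ≤ _ := by gcongr <;> simp
      · simp only [Real.dist_eq]
        rw [← mul_sub, abs_mul]
        gcongr
        · exact hQt.trans (le_max_right _ _)
        · exact le_max_left _ _)
    ⟨ha.1, hb.1⟩
    (fun t ht => ⟨(h1 t (hs t ht)).prodMk (h2 t (hs t ht)), mem_univ _⟩)
    (fun t ht => ⟨(h3 t (hs t ht)).prodMk (h4 t (hs t ht)), mem_univ _⟩)
    (by simp [e1, e2])
  exact congrArg Prod.fst (this ⟨ha.2, hb.2⟩)

theorem nsol_unique (q φ φd ψ ψd : ℝ → ℝ) (μ : ℝ) (hμ : 1 / 2 ≤ μ) (hq : ContinuousOn q (Ioo 0 1))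
    (h1 : ∀ x ∈ Ioo (0:ℝ) 1, HasDerivAt φ (φd x) x)
    (h2 : ∀ x ∈ Ioo (0:ℝ) 1, HasDerivAt φd (q x * φ x) x)
    (h3 : ∀ x ∈ Ioo (0:ℝ) 1, HasDerivAt ψ (ψd x) x)
    (h4 : ∀ x ∈ Ioo (0:ℝ) 1, HasDerivAt ψd (q x * ψ x) x)
    (t1 : Tendsto (fun x : ℝ => x ^ (-μ) * φ x) (nhdsWithin 0 (Ioi 0)) (nhds 1))
    (t2 : Tendsto (fun x : ℝ => x ^ (-μ) * ψ x) (nhdsWithin 0 (Ioi 0)) (nhds 1)) :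
    EqOn φ ψ (Ioo 0 1) := by
  have ev := t1.eventually (Ioo_mem_nhds (show (1/2:ℝ) < 1 by norm_num) (show (1:ℝ) < 2 by norm_num))
  obtain ⟨δ', hδ', hev⟩ := mem_nhdsGT_iff_exists_Ioo_subset.1 ev
  obtain ⟨δ, hδ0, hδ⟩ := exists_between (lt_min (show (0:ℝ) < δ' from hδ') one_pos)
  rw [lt_min_iff] at hδ
  have hsub : ∀ x ∈ Ioo 0 δ, x ∈ Ioo (0:ℝ) 1 := fun x hx => ⟨hx.1, hx.2.trans hδ.2⟩
  have key : ∀ x ∈ Ioo 0 δ, 0 < φ x ∧ φ x ^ 2 ≤ 4 * x := by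
    intro x hx
    have h : x ^ (-μ) * φ x ∈ Ioo (1/2 : ℝ) 2 := hev ⟨hx.1, hx.2.trans hδ.1⟩
    have hp := Real.rpow_pos_of_pos hx.1 μ
    have e : φ x = x ^ μ * (x ^ (-μ) * φ x) := by
      rw [← mul_assoc, ← Real.rpow_add hx.1]; simp
    set y := x ^ (-μ) * φ x
    have hy0 : 0 < y := by linarith [h.1]
    refine ⟨by rw [e]; positivity, ?_⟩
    rw [e, mul_pow]
    have e2 : (x ^ μ) ^ 2 ≤ x := by
      rw [← Real.rpow_natCast, ← Real.rpow_mul hx.1.le]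
      calc _ ≤ x ^ (1:ℝ) := Real.rpow_le_rpow_of_exponent_ge hx.1 (hsub x hx).2.le
            (by push_cast; linarith)
        _ = x := Real.rpow_one x
    have e3 : y ^ 2 ≤ 4 := by nlinarith [h.2]
    nlinarith [hx.1, sq_nonneg y]
  obtain ⟨w, hw⟩ := isOpen_Ioo.exists_is_const_of_deriv_eq_zero
    (f := fun x => ψd x * φ x - ψ x * φd x) (s := Ioo (0:ℝ) 1) isPreconnected_Ioo
    (fun x hx => (((h4 x hx).mul (h1 x hx)).sub
      ((h3 x hx).mul (h2 x hx))).differentiableAt.differentiableWithinAt)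
    (fun x hx => by
      refine (((h4 x hx).mul (h1 x hx)).sub ((h3 x hx).mul (h2 x hx))).deriv.trans ?_
      simp only [Pi.zero_apply]; ring)
  have hr : ∀ x ∈ Ioo 0 δ, HasDerivAt (fun x => ψ x / φ x) (w / φ x ^ 2) x := by
    intro x hx
    have := (h3 x (hsub x hx)).div (h1 x (hsub x hx)) (key x hx).1.ne'
    have e : ψd x * φ x - ψ x * φd x = w := hw x (hsub x hx)
    rw [e] at this
    exact this
  have tr : Tendsto (fun x => ψ x / φ x) (nhdsWithin 0 (Ioi 0)) (nhds 1) := by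
    have := t2.div t1 one_ne_zero
    rw [div_one] at this
    refine this.congr' ?_
    filter_upwards [self_mem_nhdsWithin] with x hx
    exact mul_div_mul_left _ _ (Real.rpow_pos_of_pos hx _).ne'
  have hmid : δ / 2 ∈ Ioo 0 δ := ⟨by linarith, by linarith⟩
  have hIoo : Ioo 0 (δ / 2) ∈ nhdsWithin (0:ℝ) (Ioi 0) := Ioo_mem_nhdsGT (by linarith)
  have hw0 : w = 0 := by
    by_contra hne
    have hd : ∀ x ∈ Ioo 0 δ, HasDerivAt (fun x => w * (ψ x / φ x) - w ^ 2 / 4 * Real.log x)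
        (w * (w / φ x ^ 2) - w ^ 2 / 4 * x⁻¹) x := fun x hx =>
      ((hr x hx).const_mul w).sub ((Real.hasDerivAt_log hx.1.ne').const_mul _)
    have mono : MonotoneOn (fun x => w * (ψ x / φ x) - w ^ 2 / 4 * Real.log x) (Ioo 0 δ) := by
      refine monotoneOn_of_deriv_nonneg (convex_Ioo _ _)
        (fun x hx => (hd x hx).continuousAt.continuousWithinAt) ?_ ?_
      · rw [interior_Ioo]
        exact fun x hx => (hd x hx).differentiableAt.differentiableWithinAt
      · rw [interior_Ioo]
        intro x hx
        rw [(hd x hx).deriv]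
        have hφ := key x hx
        have hx0 := hx.1
        have hφ0 := hφ.1
        have : w * (w / φ x ^ 2) - w ^ 2 / 4 * x⁻¹ = w ^ 2 * (1 / φ x ^ 2 - 1 / (4 * x)) := by
          field_simp
        rw [this]
        refine mul_nonneg (sq_nonneg _) (sub_nonneg.2 ?_)
        exact one_div_le_one_div_of_le (by positivity) hφ.2
    have tt : Tendsto (fun x => w * (ψ x / φ x) + (w ^ 2 / 4) * (-Real.log x))
        (nhdsWithin 0 (Ioi 0)) atTop := by
      refine (tr.const_mul w).add_atTop ?_
      exact (tendsto_neg_atBot_atTop.comp Real.tendsto_log_nhdsGT_zero).const_mul_atTop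
        (by positivity)
    have e1 := tt.eventually_gt_atTop (w * (ψ (δ/2) / φ (δ/2)) - w ^ 2 / 4 * Real.log (δ/2))
    obtain ⟨x, hx1, hx2⟩ := (e1.and hIoo).exists
    have := mono (show x ∈ Ioo 0 δ from ⟨hx2.1, by linarith [hx2.2]⟩) hmid hx2.2.le
    simp only at this
    linarith
  have hr1 : ψ (δ/2) / φ (δ/2) = 1 := by
    obtain ⟨a, ha⟩ := isOpen_Ioo.exists_is_const_of_deriv_eq_zero
      (f := fun x => ψ x / φ x) (s := Ioo (0:ℝ) δ) isPreconnected_Ioo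
      (fun x hx => (hr x hx).differentiableAt.differentiableWithinAt)
      (fun x hx => by rw [(hr x hx).deriv, hw0]; simp)
    have : Tendsto (fun x => ψ x / φ x) (nhdsWithin 0 (Ioi 0)) (nhds a) := by
      refine tendsto_const_nhds.congr' ?_
      filter_upwards [hIoo] with x hx
      exact (ha x ⟨hx.1, by linarith [hx.2]⟩).symm
    exact (ha _ hmid).trans (tendsto_nhds_unique this tr)
  have hφ := (key _ hmid).1
  have e1 : ψ (δ/2) = φ (δ/2) := by rwa [div_eq_one_iff_eq hφ.ne'] at hr1
  have e2 : ψd (δ/2) * φ (δ/2) - ψ (δ/2) * φd (δ/2) = 0 := (hw _ (hsub _ hmid)).trans hw0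
  refine nsol_ode q φ φd ψ ψd hq h1 h2 h3 h4 (δ/2) (hsub _ hmid) e1.symm ?_
  rw [e1] at e2
  have : (ψd (δ/2) - φd (δ/2)) * φ (δ/2) = 0 := by linarith
  rcases mul_eq_zero.1 this with h | h
  · linarith
  · exact absurd h hφ.ne'

theorem normalized_solution_exists_unique (N : ℕ) (hN : 0 < N) (a₀ : ℝ → ℝ)
    (ha : ContDiffOn ℝ (⊤ : ℕ∞) a₀ (Ico 0 1)) (ha0 : -1/4 ≤ a₀ 0) :
    let q : ℝ → ℝ := fun x => a₀ (x ^ (1 / (N : ℝ))) * (x ^ (-2 : ℤ) : ℝ)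
    let ν₀ : ℝ := Real.sqrt (a₀ 0 + 1/4)
    ∃ φ : ℝ → ℝ,
      (ContDiffOn ℝ 2 φ (Ioo 0 1) ∧
       (∀ x ∈ Ioo (0:ℝ) 1, deriv (deriv φ) x = q x * φ x) ∧
       Tendsto (fun x : ℝ => x ^ (-(ν₀ + 1/2)) * φ x) (nhdsWithin 0 (Ioi 0)) (nhds 1)) ∧
      (∃ C : ℝ, ∀ᶠ x in nhdsWithin (0:ℝ) (Ioi 0),
        |φ x - x ^ (ν₀ + 1/2)| ≤ C * x ^ (ν₀ + 1/2 + 1 / (N : ℝ))) ∧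
      (∀ ψ : ℝ → ℝ,
        (ContDiffOn ℝ 2 ψ (Ioo 0 1) ∧
         (∀ x ∈ Ioo (0:ℝ) 1, deriv (deriv ψ) x = q x * ψ x) ∧
         Tendsto (fun x : ℝ => x ^ (-(ν₀ + 1/2)) * ψ x) (nhdsWithin 0 (Ioi 0)) (nhds 1)) →
        EqOn φ ψ (Ioo 0 1)) := by
  intro q ν₀
  have hν : 0 ≤ ν₀ := Real.sqrt_nonneg _
  have hν2 : ν₀ ^ 2 = a₀ 0 + 1/4 := Real.sq_sqrt (by linarith)
  clear_value ν₀
  have hα : (0:ℝ) < 1 / (N : ℝ) := by positivity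
  set α : ℝ := 1 / (N : ℝ) with hαdef
  have hqe : ∀ x, q x = a₀ (x ^ α) * (x ^ (-2 : ℤ) : ℝ) := fun x => rfl
  clear_value α
  have hac : ContinuousOn (fun x : ℝ => a₀ (x ^ α)) (Ioo 0 1) :=
    ha.continuousOn.comp (nsol_pow_cont α 1) (fun x hx =>
      ⟨(Real.rpow_pos_of_pos hx.1 α).le, Real.rpow_lt_one hx.1.le hx.2 hα⟩)
  have hq : ContinuousOn q (Ioo 0 1) :=
    (hac.mul (fun x hx => (continuousAt_zpow₀ x (-2) (Or.inl hx.1.ne')).continuousWithinAt)).congr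
      (fun x _ => hqe x)
  obtain ⟨u, P, huP, C, hC⟩ := nsol_exists ν₀ α hν hα (fun x => a₀ (x ^ α) - a₀ 0)
    (hac.sub continuousOn_const) (fun R hR => nsol_lip α hα a₀ ha R hR)
  set φ : ℝ → ℝ := fun x => x ^ (ν₀ + 1/2) * u x with hφ
  set φd : ℝ → ℝ := fun x => (ν₀ + 1/2) * x ^ (ν₀ - 1/2) * u x + x ^ (-ν₀ - 1/2) * P x with hφd
  have h1 : ∀ x ∈ Ioo (0:ℝ) 1, HasDerivAt φ (φd x) x := by
    intro x hx
    have := (Real.hasDerivAt_rpow_const (p := ν₀ + 1/2) (Or.inl hx.1.ne')).mul (huP x hx).1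
    refine this.congr_deriv ?_
    simp only [hφd]
    rw [← mul_assoc, ← Real.rpow_add hx.1]
    ring_nf
  have h2 : ∀ x ∈ Ioo (0:ℝ) 1, HasDerivAt φd (q x * φ x) x := by
    intro x hx
    have := (((Real.hasDerivAt_rpow_const (p := ν₀ - 1/2) (Or.inl hx.1.ne')).const_mul
      (ν₀ + 1/2)).mul (huP x hx).1).add
      ((Real.hasDerivAt_rpow_const (p := -ν₀ - 1/2) (Or.inl hx.1.ne')).mul (huP x hx).2)
    refine this.congr_deriv ?_
    have e1 : x ^ (ν₀ - 1/2 - 1) = x ^ (ν₀ + 1/2) * x ^ (-2 : ℤ) := by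
      rw [← Real.rpow_intCast, ← Real.rpow_add hx.1]; congr 1; push_cast; ring
    have e2 : x ^ (-ν₀ - 1/2) * x ^ (2 * ν₀ - 1) = x ^ (ν₀ + 1/2) * x ^ (-2 : ℤ) := by
      rw [← Real.rpow_intCast, ← Real.rpow_add hx.1, ← Real.rpow_add hx.1]
      congr 1; push_cast; ring
    have e3 : x ^ (ν₀ - 1/2) * x ^ (-2 * ν₀ - 1) = x ^ (-ν₀ - 1/2 - 1) := by
      rw [← Real.rpow_add hx.1]; congr 1; ring
    simp only [hqe, hφ]
    have ea : a₀ 0 = ν₀ ^ 2 - 1/4 := by linarith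
    rw [ea]
    linear_combination ((ν₀ + 1/2) * (ν₀ - 1/2) * u x) * e1
      + (a₀ (x ^ α) - (ν₀ ^ 2 - 1/4)) * u x * e2 + (ν₀ + 1/2) * P x * e3
  have hd1 : EqOn (deriv φ) φd (Ioo 0 1) := fun x hx => (h1 x hx).deriv
  have hd2 : ∀ x ∈ Ioo (0:ℝ) 1, HasDerivAt (deriv φ) (q x * φ x) x := fun x hx =>
    (h2 x hx).congr_of_eventuallyEq (hd1.eventuallyEq_of_mem (isOpen_Ioo.mem_nhds hx))
  have hO : ∀ x ∈ Ioo (0:ℝ) (1/2), |φ x - x ^ (ν₀ + 1/2)| ≤ C * x ^ (ν₀ + 1/2 + α) := by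
    intro x hx
    have hp := Real.rpow_pos_of_pos hx.1 (ν₀ + 1/2)
    rw [show φ x - x ^ (ν₀ + 1/2) = x ^ (ν₀ + 1/2) * (u x - 1) by simp only [hφ]; ring,
      abs_mul, abs_of_pos hp, Real.rpow_add hx.1 (ν₀ + 1/2) α]
    nlinarith [hC x hx]
  have hhalf : Ioo (0:ℝ) (1/2) ∈ nhdsWithin (0:ℝ) (Ioi 0) := Ioo_mem_nhdsGT (by norm_num)
  have hu1 : Tendsto u (nhdsWithin 0 (Ioi 0)) (nhds 1) := by
    rw [tendsto_iff_norm_sub_tendsto_zero]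
    have t0 : Tendsto (fun x : ℝ => C * x ^ α) (nhdsWithin 0 (Ioi 0)) (nhds 0) := by
      have : Tendsto (fun x : ℝ => C * x ^ α) (nhds 0) (nhds (C * 0 ^ α)) :=
        (Real.continuousAt_rpow_const 0 α (Or.inr hα.le)).tendsto.const_mul C
      rw [Real.zero_rpow hα.ne', mul_zero] at this
      exact this.mono_left nhdsWithin_le_nhds
    refine squeeze_zero' (Eventually.of_forall fun x => norm_nonneg _) ?_ t0
    filter_upwards [hhalf] with x hx using hC x hx
  have ht : Tendsto (fun x : ℝ => x ^ (-(ν₀ + 1/2)) * φ x) (nhdsWithin 0 (Ioi 0)) (nhds 1) := by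
    refine hu1.congr' ?_
    filter_upwards [self_mem_nhdsWithin] with x hx
    simp only [hφ]
    rw [← mul_assoc, ← Real.rpow_add hx]
    simp
  refine ⟨φ, ⟨?_, fun x hx => (hd2 x hx).deriv, ht⟩, ⟨C, ?_⟩, ?_⟩
  · rw [show (2 : WithTop ℕ∞) = 1 + 1 by norm_num, contDiffOn_succ_iff_deriv_of_isOpen isOpen_Ioo]
    refine ⟨fun x hx => (h1 x hx).differentiableAt.differentiableWithinAt, by simp, ?_⟩
    rw [show (1 : WithTop ℕ∞) = 0 + 1 by norm_num, contDiffOn_succ_iff_deriv_of_isOpen isOpen_Ioo]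
    refine ⟨fun x hx => (hd2 x hx).differentiableAt.differentiableWithinAt, by simp, ?_⟩
    rw [contDiffOn_zero]
    have hφc : ContinuousOn φ (Ioo 0 1) :=
      fun x hx => (h1 x hx).continuousAt.continuousWithinAt
    exact (hq.mul hφc).congr fun x hx => (hd2 x hx).deriv
  · filter_upwards [hhalf] with x hx using hO x hx
  · rintro ψ ⟨hψ, hψ2, hψt⟩
    rw [show (2 : WithTop ℕ∞) = 1 + 1 by norm_num,
      contDiffOn_succ_iff_deriv_of_isOpen isOpen_Ioo] at hψ
    have hψd : DifferentiableOn ℝ (deriv ψ) (Ioo 0 1) := hψ.2.2.differentiableOn (by norm_num)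
    refine nsol_unique q φ φd ψ (deriv ψ) (ν₀ + 1/2) (by linarith) hq h1 h2
      (fun x hx => ((hψ.1 x hx).differentiableAt (isOpen_Ioo.mem_nhds hx)).hasDerivAt)
      (fun x hx => ?_) ht hψt
    have := ((hψd x hx).differentiableAt (isOpen_Ioo.mem_nhds hx)).hasDerivAt
    rwa [hψ2 x hx] at this
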